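/- arXiv:2202.06536 — 3 statements merged into one kernel-verified Lean document; each statement's English description precedes it below -/
import Mathlib

section
/- Let Λ > 0 and set μ = √(Λ/3). Suppose K : (0,∞) → ℝ is differentiable and satisfies, for all t > 0, the lower bound K(t) ≥ √(3Λ) and the differential inequality K'(t) ≤ Λ − K(t)²/3. Then K(t) ≤ √(3Λ)·coth(μ t) for all t > 0; that is, the expansion approaches the de Sitter value √(3Λ) exponentially fast, within a few times the characteristic time 1/√Λ. -/
/-- Along a solution of `K' ≤ 3μ² - K²/3` with `K ≥ 3μ > 0`, the Möbius transform of `K` sending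
`3μ` to `0` and `∞` to `1` decays at least as fast as `exp (-2μt)`. -/
lemma antitoneOn_moebius_mul_exp {μ : ℝ} (hμ : 0 < μ) {K K' : ℝ → ℝ}
    (hder : ∀ t > (0 : ℝ), HasDerivAt K (K' t) t)
    (hlow : ∀ t > (0 : ℝ), 3 * μ ≤ K t)
    (hray : ∀ t > (0 : ℝ), K' t ≤ 3 * μ ^ 2 - K t ^ 2 / 3) :
    AntitoneOn (fun t => (K t - 3 * μ) / (K t + 3 * μ) * Real.exp (2 * μ * t)) (Set.Ioi 0) := by
  have hpos : ∀ t > (0 : ℝ), 0 < K t + 3 * μ := fun t ht => by linarith [hlow t ht]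
  have hq : ∀ t > (0 : ℝ), HasDerivAt
      (fun t => (K t - 3 * μ) / (K t + 3 * μ) * Real.exp (2 * μ * t))
      (6 * μ * (K' t - (3 * μ ^ 2 - K t ^ 2 / 3)) / (K t + 3 * μ) ^ 2 *
        Real.exp (2 * μ * t)) t := fun t ht => by
    have hne := (hpos t ht).ne'
    have hexp : HasDerivAt (fun t : ℝ => Real.exp (2 * μ * t))
        (Real.exp (2 * μ * t) * (2 * μ * 1)) t :=
      ((hasDerivAt_id t).const_mul (2 * μ)).exp
    refine ((((hder t ht).sub_const (3 * μ)).fun_div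
      ((hder t ht).add_const (3 * μ)) hne).fun_mul hexp).congr_deriv ?_
    field_simp
    ring
  refine antitoneOn_of_hasDerivWithinAt_nonpos (convex_Ioi 0)
    (fun t ht => (hq t ht).continuousAt.continuousWithinAt)
    (fun t ht => (hq t (interior_subset ht)).hasDerivWithinAt) fun t ht => ?_
  have ht0 : 0 < t := interior_subset ht
  refine mul_nonpos_of_nonpos_of_nonneg (div_nonpos_of_nonpos_of_nonneg ?_ (sq_nonneg _))
    (Real.exp_pos _).le
  exact mul_nonpos_of_nonneg_of_nonpos (by positivity) (sub_nonpos.2 (hray t ht0))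

/-- Wald's expansion bound: if the volume expansion `K` satisfies `K ≥ √(3Λ)` and the
Raychaudhuri inequality `K' ≤ Λ − K²/3` on `(0,∞)`, then
`K(t) ≤ √(3Λ) coth(μ t)` with `μ = √(Λ/3)`, so `K` approaches the de Sitter value
exponentially fast. -/
theorem wald_expansion_bound (Λ : ℝ) (hΛ : 0 < Λ) (μ : ℝ)
    (hμ : μ = Real.sqrt (Λ / 3)) (K K' : ℝ → ℝ)
    (hder : ∀ t > (0 : ℝ), HasDerivAt K (K' t) t)
    (hlow : ∀ t > (0 : ℝ), Real.sqrt (3 * Λ) ≤ K t)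
    (hray : ∀ t > (0 : ℝ), K' t ≤ Λ - K t ^ 2 / 3) :
    ∀ t > (0 : ℝ), K t ≤ Real.sqrt (3 * Λ) * (Real.cosh (μ * t) / Real.sinh (μ * t)) := by
  intro t ht
  have hμ0 : 0 < μ := hμ ▸ Real.sqrt_pos.2 (by positivity)
  have hΛμ : Λ = 3 * μ ^ 2 := by
    rw [hμ, Real.sq_sqrt (by positivity)]
    ring
  have hs : Real.sqrt (3 * Λ) = 3 * μ := by
    rw [hΛμ, show 3 * (3 * μ ^ 2) = (3 * μ) ^ 2 by ring, Real.sqrt_sq (by positivity)]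
  rw [hs] at hlow ⊢
  rw [hΛμ] at hray
  have hanti := antitoneOn_moebius_mul_exp hμ0 hder hlow hray
  have hpos : ∀ t > (0 : ℝ), 0 < K t + 3 * μ := fun t ht => by linarith [hlow t ht]
  have hle : (K t - 3 * μ) / (K t + 3 * μ) * Real.exp (2 * μ * t) ≤ 1 := by
    have hlim : Filter.Tendsto (fun ε : ℝ => Real.exp (2 * μ * ε))
        (nhdsWithin 0 (Set.Ioi 0)) (nhds 1) := by
      have hcont : Continuous fun ε : ℝ => Real.exp (2 * μ * ε) := by fun_prop
      simpa using (hcont.tendsto 0).mono_left nhdsWithin_le_nhds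
    refine ge_of_tendsto hlim ?_
    filter_upwards [Ioo_mem_nhdsGT ht] with ε hε
    refine (hanti hε.1 ht hε.2.le).trans (mul_le_of_le_one_left (Real.exp_pos _).le ?_)
    rw [div_le_one (hpos ε hε.1)]
    linarith
  rw [div_mul_eq_mul_div, div_le_one (hpos t ht),
    show 2 * μ * t = μ * t + μ * t by ring, Real.exp_add] at hle
  rw [← mul_div_assoc, le_div_iff₀ (Real.sinh_pos_iff.2 (mul_pos hμ0 ht)),
    Real.sinh_eq, Real.cosh_eq]
  have hinv : Real.exp (μ * t) * Real.exp (-(μ * t)) = 1 := by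
    rw [← Real.exp_add, add_neg_cancel, Real.exp_zero]
  have hmul := mul_le_mul_of_nonneg_right hle (Real.exp_pos (-(μ * t))).le
  rw [mul_assoc, mul_assoc, hinv, mul_one] at hmul
  linarith
end

section
/- Let Λ > 0, μ = √(Λ/3). Suppose K : (0,∞) → ℝ is differentiable with K(t) ≥ √(3Λ) and K'(t) ≤ Λ − K(t)²/3 for all t > 0, and suppose σ2 : (0,∞) → ℝ satisfies 0 ≤ σ2(t) ≤ K(t)²/3 − Λ for all t > 0. Then the shear obeys σ2(t) ≤ Λ / sinh²(μ t) for all t > 0, so the anisotropy decays to zero exponentially fast on the timescale 1/√Λ. -/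
/-- A solution of the Riccati inequality `K' ≤ 3μ² − K²/3` on `(0,∞)` with `K ≥ 3μ > 0` is bounded
by the solution `3μ coth(μ t)` which blows up at `t = 0`. -/
theorem mul_sinh_le_of_riccati {μ : ℝ} (hμ : 0 < μ) {K K' : ℝ → ℝ}
    (hder : ∀ t > (0 : ℝ), HasDerivAt K (K' t) t)
    (hlow : ∀ t > (0 : ℝ), 3 * μ ≤ K t)
    (hray : ∀ t > (0 : ℝ), K' t ≤ 3 * μ ^ 2 - K t ^ 2 / 3) {t : ℝ} (ht : 0 < t) :
    K t * Real.sinh (μ * t) ≤ 3 * μ * Real.cosh (μ * t) := by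
  have hpos : ∀ s > (0 : ℝ), 0 < K s + 3 * μ := fun s hs => by linarith [hlow s hs]
  set G : ℝ → ℝ := fun s => (K s - 3 * μ) / (K s + 3 * μ) * Real.exp (2 * μ * s) with hG
  have hGder : ∀ s > (0 : ℝ), HasDerivAt G
      ((K' s * (K s + 3 * μ) - (K s - 3 * μ) * K' s) / (K s + 3 * μ) ^ 2 * Real.exp (2 * μ * s)
        + (K s - 3 * μ) / (K s + 3 * μ) * (Real.exp (2 * μ * s) * (2 * μ * 1))) s := fun s hs =>
    (((hder s hs).sub_const _).div ((hder s hs).add_const _) (hpos s hs).ne').mul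
      (((hasDerivAt_id s).const_mul (2 * μ)).exp)
  have hanti : AntitoneOn G (Set.Ioi 0) := by
    refine antitoneOn_of_deriv_nonpos (convex_Ioi 0)
      (fun s hs => (hGder s hs).continuousAt.continuousWithinAt)
      (fun s hs => ?_) (fun s hs => ?_) <;> rw [interior_Ioi] at hs
    · exact (hGder s hs).differentiableAt.differentiableWithinAt
    · rw [(hGder s hs).deriv]
      have h := hpos s hs
      have heq : (K' s * (K s + 3 * μ) - (K s - 3 * μ) * K' s) / (K s + 3 * μ) ^ 2
            * Real.exp (2 * μ * s)
          + (K s - 3 * μ) / (K s + 3 * μ) * (Real.exp (2 * μ * s) * (2 * μ * 1))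
          = 6 * μ * Real.exp (2 * μ * s) / (K s + 3 * μ) ^ 2
            * (K' s - (3 * μ ^ 2 - K s ^ 2 / 3)) := by
        field_simp
        ring
      rw [heq]
      exact mul_nonpos_of_nonneg_of_nonpos (by positivity) (by linarith [hray s hs])
  have hG_le : G t ≤ 1 := by
    have hlim : Filter.Tendsto (fun s : ℝ => Real.exp (2 * μ * s))
        (nhdsWithin 0 (Set.Ioi 0)) (nhds 1) := by
      have hc : Continuous fun s : ℝ => Real.exp (2 * μ * s) := by fun_prop
      simpa using (hc.tendsto 0).mono_left nhdsWithin_le_nhds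
    refine ge_of_tendsto hlim ?_
    filter_upwards [Ioo_mem_nhdsGT ht] with s hs
    refine (hanti hs.1 ht hs.2.le).trans ?_
    refine mul_le_of_le_one_left (Real.exp_pos _).le ?_
    rw [div_le_one (hpos s hs.1)]
    linarith
  have hmul : (K t - 3 * μ) * Real.exp (2 * μ * t) ≤ K t + 3 * μ := by
    simp only [hG] at hG_le
    rwa [div_mul_eq_mul_div, div_le_one (hpos t ht)] at hG_le
  have hexp : Real.exp (2 * μ * t) * Real.exp (-(μ * t)) = Real.exp (μ * t) := by
    rw [← Real.exp_add]
    ring_nf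
  have hfin := mul_le_mul_of_nonneg_right hmul (Real.exp_pos (-(μ * t))).le
  rw [mul_assoc, hexp] at hfin
  rw [Real.sinh_eq, Real.cosh_eq]
  linarith


/-- Shear decay in Wald's no-hair argument: if the expansion `K` satisfies `K ≥ √(3Λ)` and
`K' ≤ Λ − K²/3` on `(0,∞)`, and the shear scalar `σ2` satisfies
`0 ≤ σ2 ≤ K²/3 − Λ`, then `σ2(t) ≤ Λ / sinh²(μ t)` with `μ = √(Λ/3)`. -/
theorem wald_shear_bound (Λ : ℝ) (hΛ : 0 < Λ) (μ : ℝ)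
    (hμ : μ = Real.sqrt (Λ / 3)) (K K' σ2 : ℝ → ℝ)
    (hder : ∀ t > (0 : ℝ), HasDerivAt K (K' t) t)
    (hlow : ∀ t > (0 : ℝ), Real.sqrt (3 * Λ) ≤ K t)
    (hray : ∀ t > (0 : ℝ), K' t ≤ Λ - K t ^ 2 / 3)
    (hσ : ∀ t > (0 : ℝ), 0 ≤ σ2 t ∧ σ2 t ≤ K t ^ 2 / 3 - Λ) :
    ∀ t > (0 : ℝ), σ2 t ≤ Λ / Real.sinh (μ * t) ^ 2 := by
  intro t ht
  have hμ_pos : 0 < μ := hμ ▸ Real.sqrt_pos.2 (by positivity)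
  have hμ_sq : μ ^ 2 = Λ / 3 := by rw [hμ, Real.sq_sqrt (by positivity)]
  have hsqrt : Real.sqrt (3 * Λ) = 3 * μ := by
    rw [show 3 * Λ = (3 * μ) ^ 2 by linarith [mul_pow 3 μ 2], Real.sqrt_sq (by positivity)]
  have hK := mul_sinh_le_of_riccati hμ_pos hder (fun s hs => hsqrt ▸ hlow s hs)
    (fun s hs => by linarith [hray s hs]) ht
  have hsinh : 0 < Real.sinh (μ * t) := Real.sinh_pos_iff.2 (by positivity)
  have hK_nonneg : 0 ≤ K t := (Real.sqrt_nonneg _).trans (hlow t ht)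
  have hsq := pow_le_pow_left₀ (mul_nonneg hK_nonneg hsinh.le) hK 2
  rw [mul_pow, mul_pow, mul_pow, hμ_sq, Real.cosh_sq] at hsq
  refine (hσ t ht).2.trans ?_
  rw [le_div_iff₀ (by positivity)]
  linarith
end

section
/- Let m > 0 and suppose K, S : (0,∞) → ℝ with S differentiable, such that for all t > 0: S(t) ≥ 0, K(t) ≥ √(3·S(t) + 9m²), and S'(t) ≤ −(2/3)·K(t)·S(t). Then S(t) ≤ 3m² / sinh²(m t) for all t > 0. -/
/-- A nonnegative function on `(0, ∞)` whose derivative is at least `m` at every point of `(0, t]`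
is at least `m * t` at `t`. -/
lemma mul_le_of_le_deriv_Ioc {w w' : ℝ → ℝ} {m t : ℝ} (ht : 0 < t)
    (hw : ∀ s ∈ Set.Ioc 0 t, HasDerivAt w (w' s) s) (hm : ∀ s ∈ Set.Ioc 0 t, m ≤ w' s)
    (hw0 : ∀ s ∈ Set.Ioc 0 t, 0 ≤ w s) : m * t ≤ w t := by
  have hd : ∀ s ∈ Set.Ioc 0 t, HasDerivAt (fun x => w x - m * x) (w' s - m * 1) s :=
    fun s hs => (hw s hs).sub ((hasDerivAt_id s).const_mul m)
  have hmono : MonotoneOn (fun x => w x - m * x) (Set.Ioc 0 t) := by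
    refine monotoneOn_of_deriv_nonneg (convex_Ioc 0 t)
      (fun s hs => (hd s hs).continuousAt.continuousWithinAt)
      (fun s hs => (hd s (interior_subset hs)).differentiableAt.differentiableWithinAt) ?_
    intro s hs
    rw [(hd s (interior_subset hs)).deriv]
    linarith [hm s (interior_subset hs)]
  have hlim : Filter.Tendsto (fun s => m * t - m * s) (nhdsWithin 0 (Set.Ioi 0))
      (nhds (m * t)) := by
    have hc : Continuous fun s : ℝ => m * t - m * s := by fun_prop
    simpa using (hc.tendsto 0).mono_left nhdsWithin_le_nhds
  refine le_of_tendsto hlim ?_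
  filter_upwards [Ioc_mem_nhdsGT ht] with s hs
  have := hmono hs ⟨ht, le_rfl⟩ hs.2
  dsimp only at this
  linarith [hw0 s hs]

/-- If `S > 0` satisfies the differential inequality of the no-hair theorem at `s`, then
`arsinh (m / √(S / 3))`, the argument `w` with `S = 3m² / sinh² w`, has derivative at
least `m` at `s`. -/
lemma exists_hasDerivAt_arsinh_ge {S : ℝ → ℝ} {m k d s : ℝ} (hm : 0 < m)
    (hder : HasDerivAt S d s) (hS : 0 < S s) (hk : √(3 * S s + 9 * m ^ 2) ≤ k)
    (hd : d ≤ -(2 / 3) * k * S s) :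
    ∃ d', HasDerivAt (fun x => Real.arsinh (m / √(S x / 3))) d' s ∧ m ≤ d' := by
  have hR : 0 < √(S s / 3) := Real.sqrt_pos.2 (by positivity)
  have h := ((hasDerivAt_const s m).div ((hder.div_const 3).sqrt (by positivity)) hR.ne').arsinh
  refine ⟨_, h, ?_⟩
  have hR2 : S s = 3 * √(S s / 3) ^ 2 := by rw [Real.sq_sqrt (by positivity)]; ring
  have hk0 : 0 ≤ k := (Real.sqrt_nonneg _).trans hk
  have hk2 : 3 * S s + 9 * m ^ 2 ≤ k ^ 2 := (Real.sqrt_le_left hk0).1 hk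
  simp only [Pi.div_apply, smul_eq_mul]
  generalize √(S s / 3) = R at *
  rw [hR2] at hk2 hd
  have hroot : √(1 + (m / R) ^ 2) ≤ k / (3 * R) := by
    refine Real.sqrt_le_iff.2 ⟨by positivity, ?_⟩
    rw [div_pow, div_pow, ← sub_nonneg]
    have : k ^ 2 / (3 * R) ^ 2 - (1 + m ^ 2 / R ^ 2)
        = (k ^ 2 - (3 * (3 * R ^ 2) + 9 * m ^ 2)) / (9 * R ^ 2) := by
      field_simp
      ring
    rw [this]
    exact div_nonneg (sub_nonneg.2 hk2) (by positivity)
  rw [← div_eq_inv_mul, le_div_iff₀ (by positivity)]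
  refine (mul_le_mul_of_nonneg_left hroot hm.le).trans ?_
  rw [← sub_nonneg]
  have : (0 * R - m * (d / 3 / (2 * R))) / R ^ 2 - m * (k / (3 * R))
      = m * (-(2 / 3) * k * (3 * R ^ 2) - d) / (6 * R ^ 3) := by
    field_simp
    ring
  rw [this]
  exact div_nonneg (mul_nonneg hm.le (sub_nonneg.2 hd)) (by positivity)


/-- Bound on `S = (1/3)K² − E` in the cosmic no-hair theorem for Bianchi models
(except type IX) in quadratic gravity: if `S ≥ 0`, `K ≥ √(3S + 9m²)` and
`S' ≤ −(2/3) K S` on `(0,∞)`, then `S(t) ≤ 3m² / sinh²(m t)`. -/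
theorem nohair_S_bound (m : ℝ) (hm : 0 < m) (K S S' : ℝ → ℝ)
    (hder : ∀ t > (0 : ℝ), HasDerivAt S (S' t) t)
    (hpos : ∀ t > (0 : ℝ), 0 ≤ S t)
    (hK : ∀ t > (0 : ℝ), Real.sqrt (3 * S t + 9 * m ^ 2) ≤ K t)
    (hineq : ∀ t > (0 : ℝ), S' t ≤ -(2 / 3) * K t * S t) :
    ∀ t > (0 : ℝ), S t ≤ 3 * m ^ 2 / Real.sinh (m * t) ^ 2 := by
  intro t ht
  rcases (hpos t ht).eq_or_lt with h0 | hSt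
  · rw [← h0]
    positivity
  have hanti : AntitoneOn S (Set.Ioi 0) := by
    refine antitoneOn_of_deriv_nonpos (convex_Ioi 0)
      (fun s hs => (hder s hs).continuousAt.continuousWithinAt)
      (fun s hs => (hder s (interior_subset hs)).differentiableAt.differentiableWithinAt) ?_
    intro s hs
    have hs' : 0 < s := interior_subset hs
    rw [(hder s hs').deriv]
    nlinarith [hineq s hs',
      mul_nonneg ((Real.sqrt_nonneg _).trans (hK s hs')) (hpos s hs')]
  have hSpos : ∀ s ∈ Set.Ioc 0 t, 0 < S s := fun s hs => hSt.trans_le (hanti hs.1 ht hs.2)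
  have hw : ∀ s ∈ Set.Ioc 0 t,
      ∃ d', HasDerivAt (fun x => Real.arsinh (m / √(S x / 3))) d' s ∧ m ≤ d' := fun s hs =>
    exists_hasDerivAt_arsinh_ge hm (hder s hs.1) (hSpos s hs) (hK s hs.1) (hineq s hs.1)
  choose! w' hw' hmw' using hw
  have hle : m * t ≤ Real.arsinh (m / √(S t / 3)) :=
    mul_le_of_le_deriv_Ioc ht hw' hmw' fun s _ => Real.arsinh_nonneg_iff.2 (by positivity)
  have hsinh : Real.sinh (m * t) ≤ m / √(S t / 3) := by
    simpa only [Real.sinh_arsinh] using Real.sinh_le_sinh.2 hle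
  have hsinh0 : 0 < Real.sinh (m * t) := Real.sinh_pos_iff.2 (by positivity)
  have hsq := pow_le_pow_left₀ hsinh0.le hsinh 2
  rw [div_pow, Real.sq_sqrt (by positivity), le_div_iff₀ (by positivity)] at hsq
  rw [le_div_iff₀ (by positivity)]
  linarith
end
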